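/- Let (C_n, d_i, T_n) be a precyclic abelian group. Let C_n^λ = C_n/(1 − t_n)C_n be the cokernel of 1 − t_n; since ∂ ∘ (1 − t) = (1 − t) ∘ ∂', the differential ∂ descends to the Connes complex (C_•^λ, ∂), whose n-th homology is the Connes homology HC_n^λ(C). Let HC_n(C) be the n-th homology of the total complex of the cyclic bicomplex CC(C). Then the natural map HC_n(C) ⊗_ℤ ℚ → HC_n^λ(C) ⊗_ℤ ℚ is an isomorphism for every n. -/

import Mathlib

/-- The boundary `∂ = Σ_{i=0}^{n+1} (-1)^i d_i : C_{n+1} → C_n`. -/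
def bdry {C : ℕ → Type*} [∀ n, AddCommGroup (C n)]
    (d : ∀ n, ℕ → (C (n + 1) →+ C n)) (n : ℕ) : C (n + 1) →+ C n :=
  ∑ i ∈ Finset.range (n + 2), ((-1 : ℤ) ^ i) • d n i

/-- The truncated boundary `∂' = Σ_{i=0}^{n} (-1)^i d_i : C_{n+1} → C n`. -/
def bdry' {C : ℕ → Type*} [∀ n, AddCommGroup (C n)]
    (d : ∀ n, ℕ → (C (n + 1) →+ C n)) (n : ℕ) : C (n + 1) →+ C n :=
  ∑ i ∈ Finset.range (n + 1), ((-1 : ℤ) ^ i) • d n i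

/-- Iterated composition of an additive endomorphism, as an additive hom. -/
def hpow {M : Type*} [AddZeroClass M] (f : M →+ M) : ℕ → (M →+ M)
  | 0 => AddMonoidHom.id M
  | n + 1 => f.comp (hpow f n)

/-- The operator `1 - t_n : C_n → C_n`, where `t_n = (-1)^n T_n`. -/
def oneSubT {C : ℕ → Type*} [∀ n, AddCommGroup (C n)]
    (T : ∀ n, C n →+ C n) (n : ℕ) : C n →+ C n :=
  AddMonoidHom.id (C n) - ((-1 : ℤ) ^ n) • T n

/-- Total complex of the cyclic bicomplex `CC(C)` in degree `n`: a function
assigning to each row `q ≤ n` the entry in column `p = n - q`. -/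
abbrev TotCC (C : ℕ → Type*) (n : ℕ) : Type _ := ∀ q : Fin (n + 1), C q

/-- The total differential `Tot_{n+1} → Tot_n` of the cyclic bicomplex. -/
def Dtot {C : ℕ → Type*} [∀ n, AddCommGroup (C n)]
    (d : ∀ n, ℕ → (C (n + 1) →+ C n)) (T : ∀ n, C n →+ C n) (n : ℕ) :
    TotCC C (n + 1) →+ TotCC C n :=
  AddMonoidHom.mk' (fun x q =>
    if Even (n - (q : ℕ)) then
      (AddMonoidHom.id (C q) - ((-1 : ℤ) ^ (q : ℕ)) • T q) (x q.castSucc)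
        + bdry d q (x q.succ)
    else
      (∑ j ∈ Finset.range ((q : ℕ) + 1), hpow (((-1 : ℤ) ^ (q : ℕ)) • T q) j)
          (x q.castSucc)
        - bdry' d q (x q.succ))
    (by
      intro a b
      funext q
      by_cases h : Even (n - (q : ℕ)) <;>
        simp only [h, if_true, if_false, Pi.add_apply, map_add] <;>
        abel)


/-- The column-`0` (i.e. row-`n`) entry of an element of `Tot_n`. -/
def lastEntry {C : ℕ → Type*} (n : ℕ) (z : TotCC C n) : C n := z (Fin.last n)

/-! ### Endomorphisms of finite order -/

section FiniteOrder

variable {M : Type*} [AddCommGroup M]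

theorem hpow_succ_apply (f : M →+ M) (j : ℕ) (x : M) : hpow f (j + 1) x = f (hpow f j x) := rfl

theorem hpow_apply_comm (f : M →+ M) (j : ℕ) (x : M) : hpow f j (f x) = f (hpow f j x) := by
  induction j with
  | zero => rfl
  | succ j ih => rw [hpow_succ_apply, ih, hpow_succ_apply]

theorem hpow_apply_of_fixed {f : M →+ M} {x : M} (hx : f x = x) (j : ℕ) : hpow f j x = x := by
  induction j with
  | zero => rfl
  | succ j ih => rw [hpow_succ_apply, ih, hx]

theorem hpow_zsmul (c : ℤ) (f : M →+ M) (j : ℕ) : hpow (c • f) j = c ^ j • hpow f j := by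
  induction j with
  | zero => simp [hpow]
  | succ j ih =>
    ext x
    rw [hpow_succ_apply, ih]
    simp only [AddMonoidHom.smul_apply, map_zsmul, hpow_succ_apply, pow_succ, mul_smul]

theorem sum_hpow_apply_of_fixed {f : M →+ M} {x : M} (hx : f x = x) (m : ℕ) :
    (∑ j ∈ Finset.range m, hpow f j) x = m • x := by
  simp [AddMonoidHom.finsetSum_apply, hpow_apply_of_fixed hx]

theorem sum_hpow_sub (f : M →+ M) (m : ℕ) (x : M) :
    (∑ j ∈ Finset.range m, hpow f j) x - f ((∑ j ∈ Finset.range m, hpow f j) x)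
      = x - hpow f m x := by
  simp only [AddMonoidHom.finsetSum_apply, map_sum, ← hpow_succ_apply]
  rw [← Finset.sum_sub_distrib, Finset.sum_range_sub' (fun j => hpow f j x)]
  rfl

theorem sum_hpow_apply_comm (f : M →+ M) (m : ℕ) (x : M) :
    (∑ j ∈ Finset.range m, hpow f j) (f x) = f ((∑ j ∈ Finset.range m, hpow f j) x) := by
  simp only [AddMonoidHom.finsetSum_apply, map_sum, hpow_apply_comm]

theorem weighted_sum_hpow_sub (f : M →+ M) (m : ℕ) (x : M) :
    (∑ j ∈ Finset.range m, (j + 1) • hpow f j x)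
        - f (∑ j ∈ Finset.range m, (j + 1) • hpow f j x)
      = (∑ j ∈ Finset.range m, hpow f j) x - m • hpow f m x := by
  induction m with
  | zero => simp
  | succ m ih =>
    simp only [Finset.sum_range_succ, map_add, AddMonoidHom.add_apply, map_nsmul,
      ← hpow_succ_apply]
    rw [add_sub_add_comm, ih]
    simp only [add_smul, one_smul]
    abel

/-- If the norm of `x` vanishes then a multiple of `x` lies in the image of `1 - f`. -/
theorem exists_sub_eq_of_sum_hpow_eq_zero {f : M →+ M} {m : ℕ}
    (hf : hpow f m = AddMonoidHom.id M) {x : M}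
    (hx : (∑ j ∈ Finset.range m, hpow f j) x = 0) : ∃ y, y - f y = m • x := by
  refine ⟨-∑ j ∈ Finset.range m, (j + 1) • hpow f j x, ?_⟩
  have h := weighted_sum_hpow_sub f m x
  rw [hx, hf, zero_sub, AddMonoidHom.id_apply] at h
  rw [map_neg, ← neg_sub', h, neg_neg]

end FiniteOrder

/-! ### Reindexing double sums -/

theorem sum_sum_eq_zero_of_antisymm {M : Type*} [AddCommGroup M] (f : ℕ → ℕ → M) (m : ℕ)
    (h : ∀ i j, i < j → j ≤ m → f i j = -f (j - 1) i) :
    ∑ i ∈ Finset.range m, ∑ j ∈ Finset.range (m + 1), f i j = 0 := by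
  induction m with
  | zero => simp
  | succ m ih =>
    have h1 : ∑ i ∈ Finset.range m, f i (m + 1) = -∑ i ∈ Finset.range m, f m i := by
      rw [← Finset.sum_neg_distrib]
      refine Finset.sum_congr rfl fun i hi => ?_
      have := Finset.mem_range.1 hi
      exact h i (m + 1) (by omega) le_rfl
    have h2 : f m (m + 1) = -f m m := h m (m + 1) (by omega) le_rfl
    rw [Finset.sum_range_succ]
    simp only [Finset.sum_range_succ _ (m + 1), Finset.sum_add_distrib]
    rw [ih fun i j hij hj => h i j hij (by omega), h1, h2, Finset.sum_range_succ]
    abel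

theorem sum_sum_eq_of_rotate {M : Type*} [AddCommGroup M] (f g : ℕ → ℕ → M) (n : ℕ)
    (h1 : ∀ i j, j ≤ i → i ≤ n → f i j = g j (i - j))
    (h2 : ∀ i j, i < j → j ≤ n + 1 → f i j = g (j - 1) (n + 2 + i - j)) :
    ∑ i ∈ Finset.range (n + 1), ∑ j ∈ Finset.range (n + 2), f i j
      = ∑ k ∈ Finset.range (n + 1), ∑ l ∈ Finset.range (n + 2), g k l := by
  rw [← Finset.sum_product', ← Finset.sum_product']
  refine Finset.sum_nbij'
    (fun x => if x.2 ≤ x.1 then (x.2, x.1 - x.2) else (x.2 - 1, n + 2 + x.1 - x.2))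
    (fun y => if y.1 + y.2 ≤ n then (y.1 + y.2, y.1) else (y.1 + y.2 - (n + 1), y.1 + 1))
    ?_ ?_ ?_ ?_ ?_
  · rintro ⟨i, j⟩ hx
    simp only [Finset.mem_product, Finset.mem_range] at hx ⊢
    split_ifs <;> simp only <;> omega
  · rintro ⟨k, l⟩ hx
    simp only [Finset.mem_product, Finset.mem_range] at hx ⊢
    split_ifs <;> simp only <;> omega
  · rintro ⟨i, j⟩ hx
    simp only [Finset.mem_product, Finset.mem_range] at hx ⊢
    split_ifs <;> dsimp only at * <;> rw [Prod.mk.injEq] <;> omega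
  · rintro ⟨k, l⟩ hx
    simp only [Finset.mem_product, Finset.mem_range] at hx ⊢
    split_ifs <;> dsimp only at * <;> rw [Prod.mk.injEq] <;> omega
  · rintro ⟨i, j⟩ hx
    simp only [Finset.mem_product, Finset.mem_range] at hx ⊢
    split_ifs with h
    · exact h1 i j h (by omega)
    · exact h2 i j (by omega) (by omega)

/-! ### Identities between the operators of a precyclic group -/

section Precyclic

variable {C : ℕ → Type*} [∀ n, AddCommGroup (C n)]

/-- The signed cyclic operator `t_n = (-1)^n T_n`. -/
abbrev signedT (T : ∀ n, C n →+ C n) (n : ℕ) : C n →+ C n := ((-1 : ℤ) ^ n) • T n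

/-- The signed face map `(-1)^i d_i`. -/
abbrev signedFace (d : ∀ n, ℕ → (C (n + 1) →+ C n)) (n i : ℕ) : C (n + 1) →+ C n :=
  ((-1 : ℤ) ^ i) • d n i

/-- The norm operator `N_n = 1 + t_n + ⋯ + t_n^n`. -/
abbrev normT (T : ∀ n, C n →+ C n) (n : ℕ) : C n →+ C n :=
  ∑ j ∈ Finset.range (n + 1), hpow (signedT T n) j

variable {d : ∀ n, ℕ → (C (n + 1) →+ C n)} {T : ∀ n, C n →+ C n}

theorem bdry_apply (n : ℕ) (x : C (n + 1)) :
    bdry d n x = ∑ i ∈ Finset.range (n + 2), signedFace d n i x := by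
  simp only [bdry, AddMonoidHom.finsetSum_apply]

theorem bdry'_apply (n : ℕ) (x : C (n + 1)) :
    bdry' d n x = ∑ i ∈ Finset.range (n + 1), signedFace d n i x := by
  simp only [bdry', AddMonoidHom.finsetSum_apply]

theorem oneSubT_apply (n : ℕ) (x : C n) : oneSubT T n x = x - signedT T n x := rfl

theorem hpow_signedT (hT : ∀ n, hpow (T n) (n + 1) = AddMonoidHom.id (C n)) (n : ℕ) :
    hpow (signedT T n) (n + 1) = AddMonoidHom.id (C n) := by
  rw [hpow_zsmul, hT, ← pow_mul, (Nat.even_mul_succ_self n).neg_one_pow, one_smul]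

theorem signedFace_signedFace
    (hd : ∀ n i j, i < j → j ≤ n + 2 →
      (d n i).comp (d (n + 1) j) = (d n (j - 1)).comp (d (n + 1) i))
    {n i j : ℕ} (hij : i < j) (hj : j ≤ n + 2) (x : C (n + 2)) :
    signedFace d n i (signedFace d (n + 1) j x)
      = -signedFace d n (j - 1) (signedFace d (n + 1) i x) := by
  obtain ⟨j, rfl⟩ : ∃ k, j = k + 1 := ⟨j - 1, by omega⟩
  have h := DFunLike.congr_fun (hd n i (j + 1) hij hj) x
  simp only [AddMonoidHom.comp_apply, Nat.add_sub_cancel] at h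
  simp only [AddMonoidHom.smul_apply, map_zsmul, Nat.add_sub_cancel, h, smul_smul, ← neg_smul]
  congr 1
  ring

theorem signedFace_zero_signedT
    (hT0 : ∀ n, (d n 0).comp (T (n + 1)) = d n (n + 1)) (n : ℕ) (x : C (n + 1)) :
    signedFace d n 0 (signedT T (n + 1) x) = signedFace d n (n + 1) x := by
  have h := DFunLike.congr_fun (hT0 n) x
  simp only [AddMonoidHom.comp_apply] at h
  simp only [AddMonoidHom.smul_apply, map_zsmul, h, pow_zero, one_smul]

theorem signedFace_succ_signedT
    (hTi : ∀ n i, 1 ≤ i → i ≤ n + 1 →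
      (d n i).comp (T (n + 1)) = (T n).comp (d n (i - 1)))
    {n i : ℕ} (hi : i ≤ n) (x : C (n + 1)) :
    signedFace d n (i + 1) (signedT T (n + 1) x) = signedT T n (signedFace d n i x) := by
  have h := DFunLike.congr_fun (hTi n (i + 1) (by omega) (by omega)) x
  simp only [AddMonoidHom.comp_apply, Nat.add_sub_cancel] at h
  simp only [AddMonoidHom.smul_apply, map_zsmul, h, smul_smul]
  congr 1
  ring

theorem signedFace_hpow_of_le
    (hTi : ∀ n i, 1 ≤ i → i ≤ n + 1 →
      (d n i).comp (T (n + 1)) = (T n).comp (d n (i - 1)))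
    {n i : ℕ} (j : ℕ) (hi : i + j ≤ n + 1) (x : C (n + 1)) :
    signedFace d n (i + j) (hpow (signedT T (n + 1)) j x)
      = hpow (signedT T n) j (signedFace d n i x) := by
  induction j with
  | zero => rfl
  | succ j ih =>
    rw [hpow_succ_apply, ← add_assoc, signedFace_succ_signedT hTi (by omega), ih (by omega),
      hpow_succ_apply]

theorem signedFace_hpow_of_lt
    (hT0 : ∀ n, (d n 0).comp (T (n + 1)) = d n (n + 1))
    (hTi : ∀ n i, 1 ≤ i → i ≤ n + 1 →
      (d n i).comp (T (n + 1)) = (T n).comp (d n (i - 1)))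
    {n i k l : ℕ} (hi : i ≤ n) (h : k + l = n + 1 + i) (hl : l ≤ n + 1) (x : C (n + 1)) :
    signedFace d n i (hpow (signedT T (n + 1)) (k + 1) x)
      = hpow (signedT T n) k (signedFace d n l x) := by
  induction i generalizing k with
  | zero =>
    rw [hpow_succ_apply, signedFace_zero_signedT hT0]
    have := signedFace_hpow_of_le hTi (i := l) k (by omega) x
    rwa [show l + k = n + 1 by omega] at this
  | succ i ih =>
    obtain ⟨k, rfl⟩ : ∃ m, k = m + 1 := ⟨k - 1, by omega⟩
    rw [hpow_succ_apply, signedFace_succ_signedT hTi (by omega), ih (by omega) (by omega),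
      hpow_succ_apply]

theorem bdry_bdry
    (hd : ∀ n i j, i < j → j ≤ n + 2 →
      (d n i).comp (d (n + 1) j) = (d n (j - 1)).comp (d (n + 1) i))
    (n : ℕ) (x : C (n + 2)) : bdry d n (bdry d (n + 1) x) = 0 := by
  simp only [bdry_apply, map_sum]
  rw [Finset.sum_comm]
  exact sum_sum_eq_zero_of_antisymm _ (n + 2) fun i j hij hj => signedFace_signedFace hd hij hj x

theorem bdry'_bdry'
    (hd : ∀ n i j, i < j → j ≤ n + 2 →
      (d n i).comp (d (n + 1) j) = (d n (j - 1)).comp (d (n + 1) i))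
    (n : ℕ) (x : C (n + 2)) : bdry' d n (bdry' d (n + 1) x) = 0 := by
  simp only [bdry'_apply, map_sum]
  rw [Finset.sum_comm]
  exact sum_sum_eq_zero_of_antisymm _ (n + 1) fun i j hij hj =>
    signedFace_signedFace hd hij (by omega) x

theorem bdry_oneSubT
    (hT0 : ∀ n, (d n 0).comp (T (n + 1)) = d n (n + 1))
    (hTi : ∀ n i, 1 ≤ i → i ≤ n + 1 →
      (d n i).comp (T (n + 1)) = (T n).comp (d n (i - 1)))
    (n : ℕ) (x : C (n + 1)) : bdry d n (oneSubT T (n + 1) x) = oneSubT T n (bdry' d n x) := by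
  have h : bdry d n (signedT T (n + 1) x)
      = signedT T n (bdry' d n x) + signedFace d n (n + 1) x := by
    rw [bdry_apply, bdry'_apply, Finset.sum_range_succ', signedFace_zero_signedT hT0, map_sum]
    congr 1
    refine Finset.sum_congr rfl fun i hi => signedFace_succ_signedT hTi ?_ x
    have := Finset.mem_range.1 hi
    omega
  have h' : bdry d n x = bdry' d n x + signedFace d n (n + 1) x := by
    rw [bdry_apply, bdry'_apply, Finset.sum_range_succ]
  rw [oneSubT_apply, oneSubT_apply, map_sub, h, h']
  abel

theorem bdry'_normT
    (hT0 : ∀ n, (d n 0).comp (T (n + 1)) = d n (n + 1))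
    (hTi : ∀ n i, 1 ≤ i → i ≤ n + 1 →
      (d n i).comp (T (n + 1)) = (T n).comp (d n (i - 1)))
    (n : ℕ) (x : C (n + 1)) : bdry' d n (normT T (n + 1) x) = normT T n (bdry d n x) := by
  rw [bdry'_apply, bdry_apply]
  simp only [normT, AddMonoidHom.finsetSum_apply, map_sum]
  refine (sum_sum_eq_of_rotate
    (fun i j => signedFace d n i (hpow (signedT T (n + 1)) j x))
    (fun k l => hpow (signedT T n) k (signedFace d n l x)) n ?_ ?_).trans Finset.sum_comm
  · intro i j hj hi
    have := signedFace_hpow_of_le hTi (i := i - j) j (by omega) x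
    rwa [Nat.sub_add_cancel hj] at this
  · intro i j hij hj
    have := signedFace_hpow_of_lt hT0 hTi (i := i) (k := j - 1) (l := n + 2 + i - j)
      (by omega) (by omega) (by omega) x
    rwa [Nat.sub_add_cancel (by omega)] at this

theorem oneSubT_normT (hT : ∀ n, hpow (T n) (n + 1) = AddMonoidHom.id (C n)) (n : ℕ) (x : C n) :
    oneSubT T n (normT T n x) = 0 := by
  rw [oneSubT_apply, sum_hpow_sub, hpow_signedT hT, AddMonoidHom.id_apply, sub_self]

theorem normT_oneSubT (hT : ∀ n, hpow (T n) (n + 1) = AddMonoidHom.id (C n)) (n : ℕ) (x : C n) :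
    normT T n (oneSubT T n x) = 0 := by
  rw [oneSubT_apply, map_sub, sum_hpow_apply_comm, sum_hpow_sub, hpow_signedT hT,
    AddMonoidHom.id_apply, sub_self]

/-! ### The cyclic bicomplex -/

/-- The horizontal differential from column `p + 1` to column `p` in row `q`. -/
def horiz (T : ∀ n, C n →+ C n) (p q : ℕ) : C q →+ C q :=
  if Even p then oneSubT T q else normT T q

/-- The vertical differential of column `p` from row `q + 1` to row `q`. -/
def vert (d : ∀ n, ℕ → (C (n + 1) →+ C n)) (p q : ℕ) : C (q + 1) →+ C q :=
  if Even p then bdry d q else -bdry' d q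

theorem Dtot_apply (n : ℕ) (x : TotCC C (n + 1)) (q : Fin (n + 1)) :
    Dtot d T n x q
      = horiz T (n - q) q (x q.castSucc) + vert d (n - q) q (x q.succ) := by
  by_cases h : Even (n - (q : ℕ))
  · simp only [Dtot, AddMonoidHom.mk'_apply, horiz, vert, h, if_true]
    rfl
  · simp only [Dtot, AddMonoidHom.mk'_apply, horiz, vert, h, if_false,
      AddMonoidHom.neg_apply, ← sub_eq_add_neg]

theorem horiz_horiz (hT : ∀ n, hpow (T n) (n + 1) = AddMonoidHom.id (C n)) (p q : ℕ) (x : C q) :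
    horiz T p q (horiz T (p + 1) q x) = 0 := by
  by_cases h : Even p
  · simp only [horiz, h, Nat.even_add_one, not_true, if_true, if_false, oneSubT_normT hT]
  · simp only [horiz, h, Nat.even_add_one, not_false_eq_true, if_true, if_false,
      normT_oneSubT hT]

theorem vert_vert
    (hd : ∀ n i j, i < j → j ≤ n + 2 →
      (d n i).comp (d (n + 1) j) = (d n (j - 1)).comp (d (n + 1) i))
    (p q : ℕ) (x : C (q + 2)) : vert d p q (vert d p (q + 1) x) = 0 := by
  by_cases h : Even p
  · simp only [vert, h, if_true, bdry_bdry hd]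
  · simp only [vert, h, if_false, AddMonoidHom.neg_apply, map_neg, bdry'_bdry' hd, neg_zero]

theorem horiz_vert_add_vert_horiz
    (hT0 : ∀ n, (d n 0).comp (T (n + 1)) = d n (n + 1))
    (hTi : ∀ n i, 1 ≤ i → i ≤ n + 1 →
      (d n i).comp (T (n + 1)) = (T n).comp (d n (i - 1)))
    (p q : ℕ) (x : C (q + 1)) :
    horiz T p q (vert d (p + 1) q x) + vert d p q (horiz T p (q + 1) x) = 0 := by
  by_cases h : Even p
  · simp only [horiz, vert, h, Nat.even_add_one, not_true, if_true, if_false,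
      AddMonoidHom.neg_apply, map_neg, bdry_oneSubT hT0 hTi, neg_add_cancel]
  · simp only [horiz, vert, h, Nat.even_add_one, not_false_eq_true, if_true, if_false,
      AddMonoidHom.neg_apply, bdry'_normT hT0 hTi, add_neg_cancel]

theorem exists_horiz_eq_nsmul (hT : ∀ n, hpow (T n) (n + 1) = AddMonoidHom.id (C n))
    {p q : ℕ} {x : C q} (hx : horiz T p q x = 0) :
    ∃ y, horiz T (p + 1) q y = (q + 1) • x := by
  by_cases h : Even p
  · simp only [horiz, h, Nat.even_add_one, not_true, if_true, if_false] at hx ⊢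
    exact ⟨x, sum_hpow_apply_of_fixed (sub_eq_zero.1 hx).symm _⟩
  · simp only [horiz, h, Nat.even_add_one, not_false_eq_true, if_true, if_false] at hx ⊢
    exact exists_sub_eq_of_sum_hpow_eq_zero (hpow_signedT hT q) hx

theorem Dtot_Dtot
    (hd : ∀ n i j, i < j → j ≤ n + 2 →
      (d n i).comp (d (n + 1) j) = (d n (j - 1)).comp (d (n + 1) i))
    (hT : ∀ n, hpow (T n) (n + 1) = AddMonoidHom.id (C n))
    (hT0 : ∀ n, (d n 0).comp (T (n + 1)) = d n (n + 1))
    (hTi : ∀ n i, 1 ≤ i → i ≤ n + 1 →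
      (d n i).comp (T (n + 1)) = (T n).comp (d n (i - 1)))
    (n : ℕ) (x : TotCC C (n + 2)) : Dtot d T n (Dtot d T (n + 1) x) = 0 := by
  funext q
  have e1 : n + 1 - ((q.castSucc : Fin (n + 2)) : ℕ) = n - q + 1 := by
    have := q.isLt
    simp only [Fin.val_castSucc]
    omega
  have e2 : n + 1 - ((q.succ : Fin (n + 2)) : ℕ) = n - q := by
    simp only [Fin.val_succ]
    omega
  rw [Dtot_apply, Dtot_apply, Dtot_apply, e1, e2, map_add, map_add]
  have h1 := horiz_horiz hT (n - q) q (x q.castSucc.castSucc)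
  have h2 := vert_vert hd (n - q) q (x q.succ.succ)
  have h3 := horiz_vert_add_vert_horiz hT0 hTi (n - q) q (x q.castSucc.succ)
  refine Eq.trans (congrArg₂ (· + ·) (congrArg (· + _) h1) (congrArg (_ + ·) h2)) ?_
  rw [zero_add, add_zero]
  exact h3

/-- A cycle of the total complex vanishing in column `0` has a multiple which is the boundary of
a chain vanishing in column `0`. -/
theorem exists_Dtot_eq_nsmul
    (hd : ∀ n i j, i < j → j ≤ n + 2 →
      (d n i).comp (d (n + 1) j) = (d n (j - 1)).comp (d (n + 1) i))
    (hT : ∀ n, hpow (T n) (n + 1) = AddMonoidHom.id (C n))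
    (hT0 : ∀ n, (d n 0).comp (T (n + 1)) = d n (n + 1))
    (hTi : ∀ n i, 1 ≤ i → i ≤ n + 1 →
      (d n i).comp (T (n + 1)) = (T n).comp (d n (i - 1)))
    {n : ℕ} {r : ℕ} (hr : r ≤ n + 1) {y : TotCC C (n + 1)} (hy : Dtot d T n y = 0)
    (hyr : ∀ q : Fin (n + 2), r ≤ q → y q = 0) :
    ∃ k : ℕ, k ≠ 0 ∧ ∃ p : TotCC C (n + 2),
      Dtot d T (n + 1) p = k • y ∧ p (Fin.last (n + 2)) = 0 := by
  induction r generalizing y with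
  | zero =>
    refine ⟨1, one_ne_zero, 0, ?_, rfl⟩
    rw [map_zero, one_smul]
    funext q
    exact (hyr q (Nat.zero_le _)).symm
  | succ r ih =>
    let q : Fin (n + 1) := ⟨r, by omega⟩
    have hq : horiz T (n - r) r (y q.castSucc) = 0 := by
      have h := congrFun hy q
      rw [Dtot_apply, hyr q.succ (by simp [q]), map_zero, add_zero] at h
      exact h
    obtain ⟨s, hs⟩ := exists_horiz_eq_nsmul hT hq
    let p₀ : TotCC C (n + 2) := Pi.single q.castSucc.castSucc s
    have hp₀ : p₀ q.castSucc.castSucc = s := Pi.single_eq_same _ _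
    have hp₀' : ∀ i : Fin (n + 3), (i : ℕ) ≠ r → p₀ i = 0 := fun i hi =>
      Pi.single_eq_of_ne (fun h => hi (by rw [h]; rfl)) _
    obtain ⟨k, hk, p, hp, hp'⟩ := ih (by omega)
      (y := (r + 1) • y - Dtot d T (n + 1) p₀)
      (by rw [map_sub, map_nsmul, hy, Dtot_Dtot hd hT hT0 hTi, smul_zero, sub_zero])
      (fun i hi => by
        rw [Pi.sub_apply, Pi.smul_apply, Dtot_apply,
          hp₀' i.succ (by simp only [Fin.val_succ]; omega), map_zero, add_zero]
        rcases hi.eq_or_lt with h | h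
        · obtain rfl : i = q.castSucc := Fin.ext h.symm
          have e : n + 1 - ((q.castSucc : Fin (n + 2)) : ℕ) = n - r + 1 := by
            simp only [Fin.val_castSucc, q]
            omega
          rw [hp₀, e, sub_eq_zero]
          exact hs.symm
        · rw [hp₀' i.castSucc (by simp only [Fin.val_castSucc]; omega), hyr i h, map_zero,
            smul_zero, sub_zero])
    refine ⟨k * (r + 1), by positivity, p + k • p₀, ?_, ?_⟩
    · rw [map_add, hp, map_nsmul, smul_sub, sub_add_cancel, mul_smul]
    · rw [Pi.add_apply, Pi.smul_apply, hp', hp₀' _ (by simp only [Fin.val_last]; omega),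
        smul_zero, add_zero]

/-- Chains with prescribed entries in the columns `0` and `1`. -/
theorem exists_totCC (n : ℕ) (w : C (n + 1)) (u : C n) :
    ∃ p : TotCC C (n + 1), p (Fin.last (n + 1)) = w ∧ p (Fin.last n).castSucc = u := by
  refine ⟨Pi.single (Fin.last (n + 1)) w + Pi.single (Fin.last n).castSucc u, ?_, ?_⟩
  · rw [Pi.add_apply, Pi.single_eq_same, Pi.single_eq_of_ne (Fin.castSucc_lt_last _).ne',
      add_zero]
  · rw [Pi.add_apply, Pi.single_eq_same, Pi.single_eq_of_ne (Fin.castSucc_lt_last _).ne,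
      zero_add]

theorem Dtot_apply_last (n : ℕ) (x : TotCC C (n + 1)) :
    Dtot d T n x (Fin.last n)
      = oneSubT T n (x (Fin.last n).castSucc) + bdry d n (x (Fin.last (n + 1))) := by
  rw [Dtot_apply]
  simp only [horiz, vert, Fin.val_last, Nat.sub_self, Even.zero, if_true]
  rfl

end Precyclic

/-- For a precyclic abelian group `(C_n, d_i, T_n)`, the natural map
`HC_n(C) → HC_n^λ(C)` (sending the class of a cycle of the total complex of `CC(C)`
to the class of its column-`0` entry in the Connes complex `C_•^λ = C_•/(1 - t)`)
becomes an isomorphism after tensoring with `ℚ`; equivalently, its kernel and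
cokernel are torsion.  This is expressed elementwise:
kernel torsion — any cycle of `Tot` whose column-`0` entry is a boundary in the
Connes complex has a nonzero multiple which is a boundary in `Tot`;
cokernel torsion — any cycle of the Connes complex has a nonzero multiple which,
modulo `(1 - t)` and Connes boundaries, is the column-`0` entry of a cycle of `Tot`. -/
theorem stmt9 (C : ℕ → Type*) [∀ n, AddCommGroup (C n)]
    (d : ∀ n, ℕ → (C (n + 1) →+ C n))
    (hd : ∀ n i j, i < j → j ≤ n + 2 →
      (d n i).comp (d (n + 1) j) = (d n (j - 1)).comp (d (n + 1) i))
    (T : ∀ n, C n →+ C n)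
    (hT : ∀ n, hpow (T n) (n + 1) = AddMonoidHom.id (C n))
    (hT0 : ∀ n, (d n 0).comp (T (n + 1)) = d n (n + 1))
    (hTi : ∀ n i, 1 ≤ i → i ≤ n + 1 →
      (d n i).comp (T (n + 1)) = (T n).comp (d n (i - 1))) :
    -- kernel is torsion, degree 0
    (∀ z : TotCC C 0,
      (∃ (w : C 1) (u : C 0), lastEntry 0 z = bdry d 0 w + oneSubT T 0 u) →
      ∃ k : ℕ, k ≠ 0 ∧ ∃ p : TotCC C 1, Dtot d T 0 p = k • z) ∧
    -- kernel is torsion, degree `n + 1`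
    (∀ n : ℕ, ∀ z : TotCC C (n + 1), Dtot d T n z = 0 →
      (∃ (w : C (n + 2)) (u : C (n + 1)),
        lastEntry (n + 1) z = bdry d (n + 1) w + oneSubT T (n + 1) u) →
      ∃ k : ℕ, k ≠ 0 ∧ ∃ p : TotCC C (n + 2), Dtot d T (n + 1) p = k • z) ∧
    -- cokernel is torsion, degree 0
    (∀ x : C 0, ∃ k : ℕ, k ≠ 0 ∧ ∃ z : TotCC C 0, ∃ (w : C 1) (u : C 0),
      k • x = lastEntry 0 z + bdry d 0 w + oneSubT T 0 u) ∧
    -- cokernel is torsion, degree `n + 1`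
    (∀ n : ℕ, ∀ x : C (n + 1), (∃ v : C n, bdry d n x = oneSubT T n v) →
      ∃ k : ℕ, k ≠ 0 ∧ ∃ z : TotCC C (n + 1), Dtot d T n z = 0 ∧
        ∃ (w : C (n + 2)) (u : C (n + 1)),
          k • x = lastEntry (n + 1) z + bdry d (n + 1) w + oneSubT T (n + 1) u) := by
  refine ⟨?_, ?_, ?_, ?_⟩
  · rintro z ⟨w, u, h⟩
    obtain ⟨p, hw, hu⟩ := exists_totCC 0 w u
    refine ⟨1, one_ne_zero, p, ?_⟩
    funext q
    obtain rfl : q = Fin.last 0 := Subsingleton.elim (α := Fin 1) _ _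
    rw [Dtot_apply_last, hw, hu, one_smul]
    exact (add_comm _ _).trans h.symm
  · rintro n z hz ⟨w, u, h⟩
    obtain ⟨p, hw, hu⟩ := exists_totCC (n + 1) w u
    obtain ⟨k, hk, p', hp', -⟩ := exists_Dtot_eq_nsmul hd hT hT0 hTi le_rfl
      (y := z - Dtot d T (n + 1) p)
      (by rw [map_sub, hz, Dtot_Dtot hd hT hT0 hTi, sub_zero])
      (fun i hi => by
        obtain rfl : i = Fin.last (n + 1) := Fin.ext (le_antisymm (Fin.le_last i) hi)
        rw [Pi.sub_apply, Dtot_apply_last, hw, hu, sub_eq_zero]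
        exact h.trans (add_comm _ _))
    refine ⟨k, hk, p' + k • p, ?_⟩
    rw [map_add, hp', map_nsmul, smul_sub, sub_add_cancel]
  · intro x
    obtain ⟨p, -, hp⟩ := exists_totCC 0 (0 : C 1) x
    refine ⟨1, one_ne_zero, fun q => p q.castSucc, 0, 0, ?_⟩
    rw [map_zero, map_zero, add_zero, add_zero, one_smul]
    exact hp.symm
  · rintro n x ⟨v, hv⟩
    obtain ⟨z, hx, hu⟩ := exists_totCC n x (-v)
    have hlast : Dtot d T n z (Fin.last n) = 0 := by
      rw [Dtot_apply_last, hx, hu, hv, map_neg, neg_add_cancel]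
    obtain ⟨k, hk, p, hp, hp'⟩ : ∃ k : ℕ, k ≠ 0 ∧ ∃ p : TotCC C (n + 1),
        Dtot d T n p = k • Dtot d T n z ∧ p (Fin.last (n + 1)) = 0 := by
      cases n with
      | zero =>
        refine ⟨1, one_ne_zero, 0, ?_, rfl⟩
        funext q
        obtain rfl : q = Fin.last 0 := Subsingleton.elim (α := Fin 1) _ _
        rw [map_zero, one_smul, hlast]
        rfl
      | succ n =>
        refine exists_Dtot_eq_nsmul hd hT hT0 hTi le_rfl (Dtot_Dtot hd hT hT0 hTi n z) ?_
        intro i hi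
        obtain rfl : i = Fin.last (n + 1) := Fin.ext (le_antisymm (Fin.le_last i) hi)
        exact hlast
    refine ⟨k, hk, k • z - p, ?_, 0, 0, ?_⟩
    · rw [map_sub, map_nsmul, hp, sub_self]
    · rw [map_zero, map_zero, add_zero, add_zero, lastEntry, Pi.sub_apply, Pi.smul_apply, hx,
        hp', sub_zero]
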